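/- For 1 < q < 2, μ_q ∈ ℝ, σ_q > 0, the function x ↦ x·p_q(x) is Lebesgue integrable on ℝ and ∫_{-∞}^{∞} x·p_q(x) dx = μ_q; i.e., the mean of the univariate q-Gaussian equals its q-mean μ_q when q < 2. -/

import Mathlib

open MeasureTheory

/-- The Euler Beta function `B(a,b) = ∫₀¹ t^(a-1) (1-t)^(b-1) dt`. -/
noncomputable def Beta (a b : ℝ) : ℝ := ∫ t in (0:ℝ)..1, t ^ (a - 1) * (1 - t) ^ (b - 1)

/-- Normalization constant of the univariate q-Gaussian:
`Z_q = (σ_q²·(3-q)/(q-1))^(1/2) · B(1/2, (3-q)/(2(q-1)))`. -/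
noncomputable def Zq (q σq : ℝ) : ℝ :=
  (σq ^ 2 * (3 - q) / (q - 1)) ^ ((1 : ℝ) / 2) * Beta (1 / 2) ((3 - q) / (2 * (q - 1)))

/-- The univariate q-Gaussian density
`p_q(x) = (1/Z_q)·(1 - ((1-q)/(3-q))·(x-μ_q)²/σ_q²)^(1/(1-q))`. -/
noncomputable def pq (q μq σq x : ℝ) : ℝ :=
  (1 / Zq q σq) * (1 - ((1 - q) / (3 - q)) * (x - μq) ^ 2 / σq ^ 2) ^ (1 / (1 - q))


lemma qG_beta (s : ℝ) : (∫ y : ℝ, (1 + y ^ 2) ^ (-s)) = Beta (1 / 2) (s - 1 / 2) := by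
  have h1 : (∫ y : ℝ, (1 + y ^ 2) ^ (-s)) = 2 * ∫ y in Set.Ioi (0:ℝ), (1 + y ^ 2) ^ (-s) := by
    rw [← integral_comp_abs (f := fun y : ℝ => (1 + y ^ 2) ^ (-s))]
    simp only [sq_abs]
  have himg : (fun y : ℝ => y ^ 2 / (1 + y ^ 2)) '' Set.Ioi 0 = Set.Ioo 0 1 := by
    ext t
    constructor
    · rintro ⟨y, hy, rfl⟩
      have hy' : 0 < y := hy
      refine ⟨by positivity, ?_⟩
      show y ^ 2 / (1 + y ^ 2) < 1
      rw [div_lt_one (by positivity)]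
      linarith
    · rintro ⟨h0, h1⟩
      have h2 : 0 < 1 - t := by linarith
      refine ⟨√(t / (1 - t)), Real.sqrt_pos.2 (by positivity), ?_⟩
      show √(t / (1 - t)) ^ 2 / (1 + √(t / (1 - t)) ^ 2) = t
      rw [Real.sq_sqrt (by positivity)]
      field_simp
      ring
  have hinj : Set.InjOn (fun y : ℝ => y ^ 2 / (1 + y ^ 2)) (Set.Ioi 0) := by
    intro a ha b hb hab
    have ha' : 0 < a := ha
    have hb' : 0 < b := hb
    have hab' : a ^ 2 / (1 + a ^ 2) = b ^ 2 / (1 + b ^ 2) := hab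
    rw [div_eq_div_iff (by positivity) (by positivity)] at hab'
    have : a ^ 2 = b ^ 2 := by linarith
    exact (pow_left_inj₀ ha'.le hb'.le two_ne_zero).1 this
  have hder : ∀ y ∈ Set.Ioi (0:ℝ), HasDerivWithinAt (fun y : ℝ => y ^ 2 / (1 + y ^ 2))
      (2 * y / (1 + y ^ 2) ^ 2) (Set.Ioi 0) y := by
    intro y _
    have hp : (1 + y ^ 2) ≠ 0 := by positivity
    have := ((hasDerivAt_pow 2 y).div ((hasDerivAt_pow 2 y).const_add 1) hp)
    refine (this.congr_deriv ?_).hasDerivWithinAt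
    field_simp
    push_cast
    ring
  have h2 := integral_image_eq_integral_abs_deriv_smul measurableSet_Ioi hder hinj
    (fun t : ℝ => t ^ ((1:ℝ) / 2 - 1) * (1 - t) ^ (s - 1 / 2 - 1))
  rw [himg] at h2
  unfold Beta
  rw [intervalIntegral.integral_of_le zero_le_one, integral_Ioc_eq_integral_Ioo, h2, h1,
    ← integral_const_mul]
  refine setIntegral_congr_fun measurableSet_Ioi ?_
  intro y hy
  have hy' : 0 < y := hy
  have hp : 0 < 1 + y ^ 2 := by positivity
  have e1 : 1 - y ^ 2 / (1 + y ^ 2) = (1 + y ^ 2)⁻¹ := by field_simp; ring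
  have e2 : (y ^ 2 : ℝ) ^ ((1:ℝ) / 2 - 1) = y⁻¹ := by
    rw [← Real.rpow_natCast, ← Real.rpow_mul hy'.le, ← Real.rpow_neg_one]
    norm_num
  have e3 : (1 + y ^ 2) ^ (-s) = (1 + y ^ 2) ^ (-(s - 1 / 2 - 1)) * (1 + y ^ 2) ^ (-((1:ℝ) / 2 - 1))
      / (1 + y ^ 2) ^ 2 := by
    rw [← Real.rpow_natCast (1 + y ^ 2) 2, ← Real.rpow_add hp, ← Real.rpow_sub hp]
    congr 1
    push_cast
    ring
  simp only [smul_eq_mul]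
  rw [e1, Real.div_rpow (by positivity) hp.le, e2, Real.inv_rpow hp.le, ← Real.rpow_neg hp.le,
    div_eq_mul_inv (y⁻¹), ← Real.rpow_neg hp.le, e3, abs_of_pos (by positivity)]
  field_simp

lemma qG_int (s : ℝ) (hs : 1 < s) : Integrable (fun y : ℝ => (1 + y ^ 2) ^ (-s)) := by
  have := integrable_rpow_neg_one_add_norm_sq (E := ℝ) (μ := volume) (r := 2 * s)
    (by simp; linarith)
  refine this.congr (Filter.Eventually.of_forall fun y => ?_)
  simp only [Real.norm_eq_abs, sq_abs]
  congr 1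
  ring

lemma qG_int' (s : ℝ) (hs : 1 < s) : Integrable (fun y : ℝ => y * (1 + y ^ 2) ^ (-s)) := by
  have := integrable_rpow_neg_one_add_norm_sq (E := ℝ) (μ := volume) (r := 2 * s - 1)
    (by simp; linarith)
  refine this.mono' ?_ (Filter.Eventually.of_forall fun y => ?_)
  · exact (by fun_prop : Measurable (fun y : ℝ => y * (1 + y ^ 2) ^ (-s))).aestronglyMeasurable
  · have hp : 0 < 1 + y ^ 2 := by positivity
    simp only [Real.norm_eq_abs, sq_abs]
    rw [abs_mul, abs_of_pos (Real.rpow_pos_of_pos hp _)]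
    have e : (1 + y ^ 2) ^ (-(2 * s - 1) / 2) = √(1 + y ^ 2) * (1 + y ^ 2) ^ (-s) := by
      rw [Real.sqrt_eq_rpow, ← Real.rpow_add hp]
      congr 1
      ring
    rw [e]
    gcongr
    exact Real.abs_le_sqrt (by linarith)

lemma qG_odd (s : ℝ) : (∫ y : ℝ, y * (1 + y ^ 2) ^ (-s)) = 0 := by
  have := integral_neg_eq_self (fun y : ℝ => y * (1 + y ^ 2) ^ (-s)) volume
  simp only [neg_sq, neg_mul, integral_neg] at this
  linarith

lemma qG_pos (s : ℝ) (hs : 1 < s) : 0 < ∫ y : ℝ, (1 + y ^ 2) ^ (-s) := by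
  have hp : ∀ y : ℝ, 0 < (1 + y ^ 2) ^ (-s) := fun y => Real.rpow_pos_of_pos (by positivity) _
  rw [integral_pos_iff_support_of_nonneg (fun y => (hp y).le) (qG_int s hs)]
  have : Function.support (fun y : ℝ => (1 + y ^ 2) ^ (-s)) = Set.univ := by
    ext y
    simpa using (hp y).ne'
  rw [this]
  simp

/-- For `1 < q < 2`, `x ↦ x·p_q(x)` is Lebesgue integrable and
`∫ x·p_q(x) dx = μ_q`: the mean of the univariate q-Gaussian equals its q-mean. -/
theorem qGaussian_mean (q μq σq : ℝ) (hq1 : 1 < q) (hq2 : q < 2) (hσ : 0 < σq) :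
    Integrable (fun x : ℝ => x * pq q μq σq x) ∧
    (∫ x : ℝ, x * pq q μq σq x) = μq := by
  have h1 : 0 < q - 1 := by linarith
  have h3 : 0 < 3 - q := by linarith
  obtain ⟨s, hs⟩ : ∃ s, s = 1 / (q - 1) := ⟨_, rfl⟩
  have hs1 : 1 < s := by rw [hs, lt_div_iff₀ h1]; linarith
  obtain ⟨c, hc⟩ : ∃ c, c = (σq ^ 2 * (3 - q) / (q - 1)) ^ ((1 : ℝ) / 2) := ⟨_, rfl⟩
  have hc0 : 0 < c := by rw [hc]; positivity
  have hc2 : c ^ 2 = σq ^ 2 * (3 - q) / (q - 1) := by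
    rw [hc, ← Real.sqrt_eq_rpow, Real.sq_sqrt (by positivity)]
  obtain ⟨I, hI⟩ : ∃ I, I = ∫ y : ℝ, (1 + y ^ 2) ^ (-s) := ⟨_, rfl⟩
  have hI0 : 0 < I := hI ▸ qG_pos s hs1
  have hZ : Zq q σq = c * I := by
    unfold Zq
    rw [← hc, hI, qG_beta]
    congr 2
    rw [hs]
    field_simp
    ring
  let k : ℝ → ℝ := fun u => 1 / (c * I) *
    (c * (u * (1 + u ^ 2) ^ (-s)) + μq * (1 + u ^ 2) ^ (-s))
  have hk1 := (qG_int' s hs1).const_mul c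
  have hk2 := (qG_int s hs1).const_mul μq
  have hk : Integrable k := (hk1.add hk2).const_mul _
  have hkI : ∫ u, k u = μq / c := by
    simp only [k]
    rw [integral_const_mul, integral_add hk1 hk2, integral_const_mul, integral_const_mul,
      qG_odd, ← hI]
    field_simp
    ring
  have hfun : (fun x : ℝ => x * pq q μq σq x) = fun x => k ((x - μq) / c) := by
    funext x
    simp only [k, pq]
    have e1 : 1 - ((1 - q) / (3 - q)) * (x - μq) ^ 2 / σq ^ 2 = 1 + ((x - μq) / c) ^ 2 := by
      rw [div_pow, hc2]
      field_simp
      ring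
    have e2 : 1 / (1 - q) = -s := by
      rw [hs, ← neg_sub q 1, div_neg]
    rw [e1, e2, hZ]
    field_simp
    ring
  rw [hfun]
  refine ⟨(hk.comp_div hc0.ne').comp_sub_right μq, ?_⟩
  rw [integral_sub_right_eq_self (fun x => k (x / c)) μq, Measure.integral_comp_div, hkI,
    abs_of_pos hc0, smul_eq_mul]
  field_simp
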